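/- arXiv:2312.14989 — 7 statements merged into one kernel-verified Lean document; each statement's English description precedes it below -/
import Mathlib

section
/- Let c ∈ ℂ with c ≠ 0 and c ≠ 1, let β ∈ ℂ, let f : ℂ → ℂ, and let s ∈ ℂ with s ≠ 0 and s + β ≠ 1. Then ∇(ρ^β · f)(s) = ρ^{β−1}(s) · ((s+β−1)·f(s) − (s/c)·f(s−1)); that is, ∇(ρ^β · f)(s) = ρ^{β−1}(s) · ((c−1)/c) · (Ψ^β f)(s). -/
/-- The Meixner weight `ρ^β(s) = c^s · Γ(s+β) / Γ(s+1)` (principal branch of `c^s`). -/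
noncomputable def meixnerWeight (c β s : ℂ) : ℂ :=
  c ^ s * Complex.Gamma (s + β) / Complex.Gamma (s + 1)

/-- The backward difference operator `(∇f)(s) = f(s) − f(s−1)`. -/
def nablaOp (f : ℂ → ℂ) : ℂ → ℂ := fun s => f s - f (s - 1)

/-- The raising operator `(Ψ^β f)(s) = (c/(c−1))·((s+β−1)·f(s) − (s/c)·f(s−1))`. -/
noncomputable def raisingOp (c β : ℂ) (f : ℂ → ℂ) : ℂ → ℂ :=
  fun s => (c / (c - 1)) * ((s + β - 1) * f s - (s / c) * f (s - 1))

theorem meixnerWeight_eq_mul_meixnerWeight_sub_one (c : ℂ) {β s : ℂ} (hsb : s + β ≠ 1) :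
    meixnerWeight c β s = (s + β - 1) * meixnerWeight c (β - 1) s := by
  have h := Complex.Gamma_add_one (s + β - 1) (sub_ne_zero.mpr hsb)
  rw [sub_add_cancel] at h
  rw [meixnerWeight, meixnerWeight, h, add_sub_assoc]
  ring

theorem meixnerWeight_apply_sub_one {c : ℂ} (hc : c ≠ 0) (β : ℂ) {s : ℂ} (hs : s ≠ 0) :
    meixnerWeight c β (s - 1) = s / c * meixnerWeight c (β - 1) s := by
  rw [meixnerWeight, meixnerWeight, Complex.Gamma_add_one s hs, sub_add_cancel,
    Complex.cpow_sub _ _ hc, Complex.cpow_one, sub_add_eq_add_sub, add_sub_assoc]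
  field_simp

/-- `∇(ρ^β · f)(s) = ρ^{β−1}(s)·((s+β−1)f(s) − (s/c)f(s−1))
= ρ^{β−1}(s)·((c−1)/c)·(Ψ^β f)(s)`. -/
theorem nabla_meixnerWeight_mul (c β : ℂ) (f : ℂ → ℂ) (s : ℂ)
    (hc0 : c ≠ 0) (hc1 : c ≠ 1) (hs : s ≠ 0) (hsb : s + β ≠ 1) :
    nablaOp (fun t => meixnerWeight c β t * f t) s =
      meixnerWeight c (β - 1) s * ((s + β - 1) * f s - (s / c) * f (s - 1)) ∧
    nablaOp (fun t => meixnerWeight c β t * f t) s =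
      meixnerWeight c (β - 1) s * ((c - 1) / c) * raisingOp c β f s := by
  have h : nablaOp (fun t => meixnerWeight c β t * f t) s =
      meixnerWeight c (β - 1) s * ((s + β - 1) * f s - (s / c) * f (s - 1)) := by
    simp only [nablaOp]
    rw [meixnerWeight_apply_sub_one hc0 β hs, meixnerWeight_eq_mul_meixnerWeight_sub_one c hsb]
    ring
  refine ⟨h, ?_⟩
  have hc : (c - 1) / c * (c / (c - 1)) = 1 := by
    have := sub_ne_zero.mpr hc1
    field_simp
  rw [h, raisingOp, mul_assoc, ← mul_assoc ((c - 1) / c), hc, one_mul]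
end

section
/- Let c ∈ ℂ with c ≠ 0 and c ≠ 1, let β ∈ ℂ, and let P be a monic polynomial over ℂ of degree n. Then there exists a monic polynomial Q over ℂ of degree n+1 such that Q(s) = (c/(c−1))·((s+β−1)·P(s) − (s/c)·P(s−1)) for all s ∈ ℂ; i.e., the raising operator Ψ^β applied to (the evaluation function of) a monic polynomial of degree n yields a monic polynomial of degree n+1. -/
open Polynomial

/-- the raising operator `Ψ^β` sends a monic polynomial of degree `n`
to a monic polynomial of degree `n+1`. -/
theorem raisingOp_monic (c β : ℂ) (hc0 : c ≠ 0) (hc1 : c ≠ 1) (n : ℕ)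
    (P : Polynomial ℂ) (hP : P.Monic) (hdeg : P.natDegree = n) :
    ∃ Q : Polynomial ℂ, Q.Monic ∧ Q.natDegree = n + 1 ∧
      ∀ s : ℂ, Q.eval s =
        (c / (c - 1)) * ((s + β - 1) * P.eval s - (s / c) * P.eval (s - 1)) := by
  have hc : c - 1 ≠ 0 := sub_ne_zero.mpr hc1
  have hA : ((X + C (β - 1)) * P).Monic := (monic_X_add_C _).mul hP
  have hAdeg : ((X + C (β - 1)) * P).natDegree = n + 1 := by
    rw [(monic_X_add_C _).natDegree_mul hP, natDegree_X_add_C, hdeg, add_comm]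
  have hS : (P.comp (X - C 1)).Monic := hP.comp_X_sub_C 1
  have hB : (X * P.comp (X - C 1)).Monic := monic_X.mul hS
  have hBdeg : (X * P.comp (X - C 1)).natDegree = n + 1 := by
    rw [monic_X.natDegree_mul hS, natDegree_X, natDegree_comp, natDegree_X_sub_C, hdeg,
      mul_one, add_comm]
  have hQdeg : (C (c / (c - 1)) * ((X + C (β - 1)) * P) -
      C (1 / (c - 1)) * (X * P.comp (X - C 1))).natDegree ≤ n + 1 :=
    (natDegree_sub_le_of_le ((natDegree_C_mul_le _ _).trans hAdeg.le)
      ((natDegree_C_mul_le _ _).trans hBdeg.le)).trans_eq (max_self _)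
  have hQcoeff : (C (c / (c - 1)) * ((X + C (β - 1)) * P) -
      C (1 / (c - 1)) * (X * P.comp (X - C 1))).coeff (n + 1) = 1 := by
    have hAcoeff := hA.coeff_natDegree
    have hBcoeff := hB.coeff_natDegree
    rw [hAdeg] at hAcoeff
    rw [hBdeg] at hBcoeff
    rw [coeff_sub, coeff_C_mul, coeff_C_mul, hAcoeff, hBcoeff]
    field_simp
  refine ⟨_, monic_of_natDegree_le_of_coeff_eq_one _ hQdeg hQcoeff,
    natDegree_eq_of_le_of_coeff_ne_zero hQdeg (hQcoeff.trans_ne one_ne_zero), fun s => ?_⟩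
  simp only [eval_sub, eval_mul, eval_add, eval_C, eval_X, eval_comp]
  field_simp
  ring
end

section
/- Let c ∈ ℂ with c ≠ 0 and c ≠ 1, let β ∈ ℂ, let k ≥ 1, and let f : ℂ → ℂ. Let s ∈ ℂ be such that s − i ≠ 0 and s + β + j − i ≠ 1 for all integers i, j with 0 ≤ i ≤ k−1 and 1 ≤ j ≤ k. Then ρ^β(s) · ((c−1)/c)^k · ((Ψ^{β+1} ∘ Ψ^{β+2} ∘ ⋯ ∘ Ψ^{β+k}) f)(s) = (∇^k(ρ^{β+k} · f))(s), i.e., the k-fold composition of raising operators equals (c/(c−1))^k · (1/ρ^β) · ∇^k ∘ (multiplication by ρ^{β+k}). -/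
/-- `R^β_k = Ψ^{β+1} ∘ Ψ^{β+2} ∘ ⋯ ∘ Ψ^{β+k}` (with `R^β_0` the identity). -/
noncomputable def iterRaising (c : ℂ) : ℂ → ℕ → (ℂ → ℂ) → (ℂ → ℂ)
  | _, 0, f => f
  | β, k + 1, f => raisingOp c (β + 1) (iterRaising c (β + 1) k f)

open Complex in
theorem meixnerWeight_add_one (c β s : ℂ) (h : s + β ≠ 0) :
    meixnerWeight c (β + 1) s = (s + β) * meixnerWeight c β s := by
  rw [meixnerWeight, meixnerWeight, ← add_assoc, Gamma_add_one _ h]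
  ring

open Complex in
theorem meixnerWeight_add_one_sub_one {c : ℂ} (hc : c ≠ 0) (β : ℂ) {s : ℂ} (hs : s ≠ 0) :
    meixnerWeight c (β + 1) (s - 1) = s / c * meixnerWeight c β s := by
  rw [meixnerWeight, meixnerWeight, show s - 1 + (β + 1) = s + β by ring, sub_add_cancel,
    Gamma_add_one _ hs, cpow_sub _ _ hc, cpow_one]
  field_simp

theorem meixnerWeight_mul_raisingOp {c : ℂ} (hc0 : c ≠ 0) (hc1 : c ≠ 1) (β : ℂ) (g : ℂ → ℂ)
    {s : ℂ} (hs : s ≠ 0) (h : s + β ≠ 0) :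
    meixnerWeight c β s * ((c - 1) / c) * raisingOp c (β + 1) g s =
      nablaOp (fun t => meixnerWeight c (β + 1) t * g t) s := by
  have hc : c - 1 ≠ 0 := sub_ne_zero.2 hc1
  simp only [nablaOp, raisingOp, meixnerWeight_add_one c β s h,
    meixnerWeight_add_one_sub_one hc0 β hs]
  field_simp
  ring

theorem iterRaising_eq_nabla_pow_of_lt (c : ℂ) (hc0 : c ≠ 0) (hc1 : c ≠ 1) (f : ℂ → ℂ)
    (k : ℕ) (β s : ℂ) (h1 : ∀ i : ℕ, i < k → s - (i : ℂ) ≠ 0)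
    (h2 : ∀ i j : ℕ, i < k → 1 ≤ j → j ≤ k → s + β + (j : ℂ) - (i : ℂ) ≠ 1) :
    meixnerWeight c β s * ((c - 1) / c) ^ k * iterRaising c β k f s =
      (nablaOp^[k] (fun t => meixnerWeight c (β + (k : ℂ)) t * f t)) s := by
  induction k generalizing β s with
  | zero => simp [iterRaising]
  | succ k ih =>
    have hs : s ≠ 0 := by simpa using h1 0 k.succ_pos
    have hβ : s + β ≠ 0 := by simpa using h2 0 1 k.succ_pos le_rfl (by omega)
    have e : β + ((k + 1 : ℕ) : ℂ) = β + 1 + k := by push_cast; ring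
    have ih_s := ih (β + 1) s (fun i hi => h1 i (by omega)) fun i j hi hj hjk h =>
      h2 i (j + 1) (by omega) (by omega) (by omega) (by rw [← h]; push_cast; ring)
    have ih_pred := ih (β + 1) (s - 1)
      (fun i hi h => h1 (i + 1) (by omega) (by rw [← h]; push_cast; ring))
      fun i j hi hj hjk h => h2 i j (by omega) hj (by omega) (by rw [← h]; ring)
    have step := meixnerWeight_mul_raisingOp hc0 hc1 β (iterRaising c (β + 1) k f) hs hβ
    rw [Function.iterate_succ_apply', e, iterRaising, pow_succ]
    simp only [nablaOp] at step
    rw [nablaOp, ← ih_s, ← ih_pred]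
    linear_combination ((c - 1) / c) ^ k * step

/-- the `k`-fold composition of raising operators equals
`(c/(c−1))^k · (1/ρ^β) · ∇^k ∘ (multiplication by ρ^{β+k})`. -/
theorem iterRaising_eq_nabla_pow (c β : ℂ) (hc0 : c ≠ 0) (hc1 : c ≠ 1)
    (k : ℕ) (hk : 1 ≤ k) (f : ℂ → ℂ) (s : ℂ)
    (h1 : ∀ i : ℕ, i ≤ k - 1 → s - (i : ℂ) ≠ 0)
    (h2 : ∀ i j : ℕ, i ≤ k - 1 → 1 ≤ j → j ≤ k → s + β + (j : ℂ) - (i : ℂ) ≠ 1) :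
    meixnerWeight c β s * ((c - 1) / c) ^ k * iterRaising c β k f s =
      (nablaOp^[k] (fun t => meixnerWeight c (β + (k : ℂ)) t * f t)) s := by
  exact iterRaising_eq_nabla_pow_of_lt c hc0 hc1 f k β s (fun i hi => h1 i (by omega))
    (fun i j hi hj hjk => h2 i j (by omega) hj hjk)
end

section
/- Let c ∈ ℂ with c ≠ 0 and c ≠ 1, let β, β' ∈ ℂ, and let k, m ∈ ℕ. Define the operators R^β_k := Ψ^{β+1} ∘ Ψ^{β+2} ∘ ⋯ ∘ Ψ^{β+k} and R^{β'}_m := Ψ^{β'+1} ∘ ⋯ ∘ Ψ^{β'+m} (with R_0 the identity). Then R^β_k and R^{β'}_m commute: for every f : ℂ → ℂ and s ∈ ℂ, (R^β_k(R^{β'}_m f))(s) = (R^{β'}_m(R^β_k f))(s). -/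
/-- Any two raising operators commute: `Ψ^β` is an affine function, with scalar coefficients,
of the operator `f ↦ s·f(s) − (s/c)·f(s−1)`, which does not depend on `β`. -/
theorem raisingOp_commute (c β γ : ℂ) :
    Function.Commute (raisingOp c β) (raisingOp c γ) := by
  intro f
  funext s
  simp only [raisingOp]
  ring

/-- An operator commuting with every raising operator commutes with their iterates. -/
theorem commute_iterRaising {c : ℂ} {T : (ℂ → ℂ) → ℂ → ℂ}
    (hT : ∀ γ, Function.Commute T (raisingOp c γ)) (β : ℂ) (k : ℕ) :
    Function.Commute T (iterRaising c β k) := by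
  induction k generalizing β with
  | zero => exact fun _ => rfl
  | succ k ih => exact (hT (β + 1)).comp_right (ih (β + 1))

/-- the operators `R^β_k` and `R^{β'}_m` commute. -/
theorem iterRaising_comm (c : ℂ) (hc0 : c ≠ 0) (hc1 : c ≠ 1) (β β' : ℂ) (k m : ℕ)
    (f : ℂ → ℂ) (s : ℂ) :
    iterRaising c β k (iterRaising c β' m f) s =
      iterRaising c β' m (iterRaising c β k f) s := by
  have h := commute_iterRaising
    (fun γ => (commute_iterRaising (raisingOp_commute c γ) β k).symm) β' m
  exact congrFun (h f) s
end

section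
/- (Explicit expression, Corollary 4.1.) Let r ≥ 1, β_0,…,β_{r−1} ∈ ℂ, c ∈ ℂ with c ≠ 0 and c ≠ 1, and n⃗ = (n_0,…,n_{r−1}) ∈ ℕ^r. Then for every s ∈ ℂ, ((Ψ^{β_0+1} ∘ ⋯ ∘ Ψ^{β_0+n_0}) ∘ ⋯ ∘ (Ψ^{β_{r−1}+1} ∘ ⋯ ∘ Ψ^{β_{r−1}+n_{r−1}}))(1)(s) = (c/(c−1))^{|n⃗|} · Σ_{k_0=0}^{n_0} ⋯ Σ_{k_{r−1}=0}^{n_{r−1}} [∏_{i=0}^{r−1} C(n_i,k_i)] · (−s)_{|k⃗|} / c^{|k⃗|} · ∏_{m=0}^{r−1} (s + β_m − |k⃗|_m + k_m)_{n_m−k_m}, where |k⃗| = k_0+⋯+k_{r−1} and |k⃗|_m = k_0+⋯+k_m. -/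
/-- Composition `R^{β_0}_{n_0} ∘ R^{β_1}_{n_1} ∘ ⋯` over a list of (parameter, degree) pairs. -/
noncomputable def multiRaising (c : ℂ) : List (ℂ × ℕ) → (ℂ → ℂ) → (ℂ → ℂ)
  | [], f => f
  | p :: t, f => iterRaising c p.1 p.2 (multiRaising c t f)

/-- Leftmost-factor recursion for the rising factorial. -/
theorem ascPochhammer_eval_succ_left (x : ℂ) (n : ℕ) :
    (ascPochhammer ℂ (n + 1)).eval x = x * (ascPochhammer ℂ n).eval (x + 1) := by
  simp [ascPochhammer_succ_left]

theorem ascPochhammer_eval_add (x : ℂ) (m n : ℕ) :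
    (ascPochhammer ℂ (m + n)).eval x =
      (ascPochhammer ℂ m).eval x * (ascPochhammer ℂ n).eval (x + m) := by
  simp [← ascPochhammer_mul]

/-- Expansion of `R^β_n f` in backward shifts of `f`. -/
theorem iterRaising_apply (c : ℂ) (f : ℂ → ℂ) (n : ℕ) (β s : ℂ) :
    iterRaising c β n f s = (c / (c - 1)) ^ n *
      ∑ k ∈ Finset.range (n + 1), (n.choose k : ℂ) *
        ((ascPochhammer ℂ k).eval (-s) / c ^ k *
          (ascPochhammer ℂ (n - k)).eval (s + β) * f (s - k)) := by
  induction n generalizing β s with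
  | zero => simp [iterRaising]
  | succ n ih =>
    rw [Finset.sum_choose_succ_mul (fun k j => (ascPochhammer ℂ k).eval (-s) / c ^ k *
      (ascPochhammer ℂ j).eval (s + β) * f (s - k)), ← Finset.sum_add_distrib]
    simp only [iterRaising, raisingOp, ih]
    rw [pow_succ', mul_assoc]
    congr 1
    rw [mul_left_comm (s + (β + 1) - 1), mul_left_comm (s / c), ← mul_sub]
    congr 1
    rw [Finset.mul_sum, Finset.mul_sum, ← Finset.sum_sub_distrib]
    refine Finset.sum_congr rfl fun k hk => ?_
    have hk' : n + 1 - k = (n - k) + 1 := by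
      have := Finset.mem_range.mp hk
      omega
    rw [hk', ascPochhammer_eval_succ_left, ascPochhammer_eval_succ_left (-s),
      show s - 1 + (β + 1) = s + β by ring, show s + (β + 1) = s + β + 1 by ring,
      show -(s - 1) = -s + 1 by ring, show s - 1 - (k : ℂ) = s - ((k + 1 : ℕ) : ℂ) by
        push_cast; ring]
    ring

theorem Fin.sum_Iic_succ {M : Type*} [AddCommMonoid M] {r : ℕ} (k : Fin (r + 1) → M)
    (m : Fin r) : ∑ i ∈ Finset.Iic m.succ, k i = k 0 + ∑ i ∈ Finset.Iic m, k i.succ := by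
  have h {q : ℕ} (a : Fin q) : Finset.Iic a = Finset.univ.filter (· ≤ a) := by
    ext; simp
  simp [h, Finset.sum_filter, Fin.sum_univ_succ]

theorem Fin.sum_piFinset_succ {M α : Type*} [AddCommMonoid M] {r : ℕ}
    (S : Fin (r + 1) → Finset α) (F : (Fin (r + 1) → α) → M) :
    ∑ k ∈ Fintype.piFinset S, F k =
      ∑ a ∈ S 0, ∑ k ∈ Fintype.piFinset (fun i : Fin r => S i.succ), F (Fin.cons a k) := by
  rw [← Finset.sum_product']
  refine Finset.sum_nbij' (fun k => (k 0, Fin.tail k)) (fun p => Fin.cons p.1 p.2)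
    ?_ ?_ ?_ ?_ ?_ <;> simp [Fintype.mem_piFinset, Fin.forall_fin_succ, Fin.tail]

/-- STATEMENT 11 (Explicit expression, Corollary 4.1) for the Rodrigues-type construction
of the type II Meixner–Angelesco polynomial of the second kind. -/
theorem meixnerAngelesco_explicit (r : ℕ) (hr : 1 ≤ r) (β : Fin r → ℂ) (c : ℂ)
    (hc0 : c ≠ 0) (hc1 : c ≠ 1) (n : Fin r → ℕ) (s : ℂ) :
    multiRaising c ((List.finRange r).map fun i => (β i, n i)) (fun _ => 1) s =
      (c / (c - 1)) ^ (∑ i, n i) *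
        ∑ k ∈ Fintype.piFinset (fun i => Finset.range (n i + 1)),
          (∏ i, ((n i).choose (k i) : ℂ)) *
            ((ascPochhammer ℂ (∑ i, k i)).eval (-s) / c ^ (∑ i, k i)) *
            ∏ m, (ascPochhammer ℂ (n m - k m)).eval
              (s + β m - ((∑ i ∈ Finset.Iic m, k i : ℕ) : ℂ) + (k m : ℂ)) := by
  clear hr
  induction r generalizing s with
  | zero => simp [multiRaising]
  | succ r ih =>
    have htail : (List.finRange (r + 1)).map (fun i => (β i, n i)) =
        (β 0, n 0) :: (List.finRange r).map (fun i : Fin r => (β i.succ, n i.succ)) := by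
      simp [List.finRange_succ, Function.comp_def]
    rw [htail, multiRaising, iterRaising_apply, Fin.sum_piFinset_succ, Fin.sum_univ_succ n,
      pow_add, mul_assoc]
    congr 1
    rw [Finset.mul_sum]
    refine Finset.sum_congr rfl fun a _ => ?_
    rw [ih, Finset.mul_sum, Finset.mul_sum, Finset.mul_sum, Finset.mul_sum]
    refine Finset.sum_congr rfl fun k _ => ?_
    have h0 : ∑ i ∈ Finset.Iic (0 : Fin (r + 1)), (Fin.cons a k : Fin (r + 1) → ℕ) i = a := by
      have : Finset.Iic (0 : Fin (r + 1)) = {0} := by ext; simp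
      simp [this]
    simp only [Fin.prod_univ_succ, Fin.sum_univ_succ, Fin.sum_Iic_succ, h0, Fin.cons_zero,
      Fin.cons_succ, ascPochhammer_eval_add, pow_add]
    have hprod : ∏ m : Fin r, (ascPochhammer ℂ (n m.succ - k m)).eval
          (s - a + β m.succ - ((∑ i ∈ Finset.Iic m, k i : ℕ) : ℂ) + (k m : ℂ)) =
        ∏ m : Fin r, (ascPochhammer ℂ (n m.succ - k m)).eval
          (s + β m.succ - ((a + ∑ i ∈ Finset.Iic m, k i : ℕ) : ℂ) + (k m : ℂ)) := by
      refine Finset.prod_congr rfl fun m _ => ?_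
      congr 1
      push_cast
      ring
    rw [hprod, show -(s - (a : ℂ)) = -s + a by ring, sub_add_cancel]
    ring
end

section
/- Let c ∈ ℂ with c ≠ 0 and c ≠ 1, β ∈ ℂ, and n ≥ 1 an integer. Write F^β_k := (Ψ^{β+1} ∘ ⋯ ∘ Ψ^{β+k})(1) (with F^β_0 the constant function 1) and id(t) = t. Then for every s ∈ ℂ, ((Ψ^{β+1} ∘ ⋯ ∘ Ψ^{β+n})(id))(s) = (s + n/(c−1)) · F^β_n(s) − (c·n·(β+n−1)/(c−1)^2) · F^β_{n−1}(s). -/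
theorem iterRaising_succ_apply (c : ℂ) (hc0 : c ≠ 0) (β : ℂ) (k : ℕ) (f : ℂ → ℂ) (s : ℂ) :
    iterRaising c β (k + 1) f s =
      (c * (s + β) * iterRaising c (β + 1) k f s -
        s * iterRaising c (β + 1) k f (s - 1)) / (c - 1) := by
  simp only [iterRaising, raisingOp]
  field_simp
  ring

/-- The constant-function iterates satisfy
`s · F^{β+1}_k(s − 1) = F^β_{k+1}(s) − (c (β + k) / (c − 1)) · F^β_k(s)`. -/
theorem mul_iterRaising_one_sub_one (c : ℂ) (hc0 : c ≠ 0) (hc1 : c ≠ 1) (k : ℕ) (β s : ℂ) :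
    s * iterRaising c (β + 1) k (fun _ => 1) (s - 1) =
      iterRaising c β (k + 1) (fun _ => 1) s -
        c * (β + (k : ℂ)) / (c - 1) * iterRaising c β k (fun _ => 1) s := by
  have hc : c - 1 ≠ 0 := sub_ne_zero.mpr hc1
  induction k generalizing β s with
  | zero =>
    rw [iterRaising_succ_apply c hc0]
    simp only [iterRaising, Nat.cast_zero]
    field_simp
    ring
  | succ k ih =>
    have h := ih (β + 1) s
    have h' := ih (β + 1) (s - 1)
    have hA := iterRaising_succ_apply c hc0 (β + 1) k (fun _ => 1) (s - 1)
    rw [iterRaising_succ_apply c hc0 β (k + 1), iterRaising_succ_apply c hc0 β k]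
    push_cast
    linear_combination s * hA + (c / (c - 1) * (s + β)) * h - (s / (c - 1)) * h'

/-- writing `F^β_k := (Ψ^{β+1}∘⋯∘Ψ^{β+k})(1)`, one has
`(Ψ^{β+1}∘⋯∘Ψ^{β+n})(id)(s) = (s + n/(c−1))·F^β_n(s) − (c·n·(β+n−1)/(c−1)^2)·F^β_{n−1}(s)`. -/
theorem iterRaising_apply_id (c β : ℂ) (hc0 : c ≠ 0) (hc1 : c ≠ 1)
    (n : ℕ) (hn : 1 ≤ n) (s : ℂ) :
    iterRaising c β n (fun t => t) s =
      (s + (n : ℂ) / (c - 1)) * iterRaising c β n (fun _ => 1) s -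
        (c * (n : ℂ) * (β + (n : ℂ) - 1) / (c - 1) ^ 2) *
          iterRaising c β (n - 1) (fun _ => 1) s := by
  have hc : c - 1 ≠ 0 := sub_ne_zero.mpr hc1
  induction n, hn using Nat.le_induction generalizing β s with
  | base =>
    simp only [iterRaising, raisingOp, Nat.cast_one, Nat.sub_self]
    field_simp
    ring
  | succ n hn ih =>
    obtain ⟨m, rfl⟩ : ∃ m, n = m + 1 := ⟨n - 1, by omega⟩
    have key := mul_iterRaising_one_sub_one c hc0 hc1 (m + 1) β s
    have hF := iterRaising_succ_apply c hc0 β (m + 1) (fun _ => 1) s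
    have hG := iterRaising_succ_apply c hc0 β m (fun _ => 1) s
    simp only [Nat.add_sub_cancel] at ih ⊢
    rw [iterRaising_succ_apply c hc0 β (m + 1) (fun t => t), ih, ih]
    push_cast at key ⊢
    simp only [div_eq_mul_inv, ← inv_pow]
    linear_combination (c - 1)⁻¹ * key - (s + (m + 1) * (c - 1)⁻¹) * hF +
      (c * (m + 1) * (β + 1 + m) * (c - 1)⁻¹ ^ 2) * hG
end

section
/- (Raising identity in explicit form.) Let r ≥ 1, β_0,…,β_{r−1} ∈ ℂ, c ∈ ℂ with c ≠ 0 and c ≠ 1, n⃗ ∈ ℕ^r, and ℓ ∈ {0,…,r−1}. Let β⃗−e_ℓ denote the parameter vector with ℓ-th entry β_ℓ−1 and the other entries unchanged. Then for every s ∈ ℂ, M_{n⃗+e_ℓ}^{β⃗−e_ℓ}(s) = (c/(c−1))·((s+β_ℓ−1)·M_{n⃗}^{β⃗}(s) − (s/c)·M_{n⃗}^{β⃗}(s−1)), where both sides are given by the explicit formula for the type II Meixner–Angelesco polynomials of the second kind. -/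
/-- The type II Meixner–Angelesco polynomial of the second kind (explicit formula,
in the variable `s = z^r`). -/
noncomputable def meixnerAngelescoII {r : ℕ} (c : ℂ) (β : Fin r → ℂ) (n : Fin r → ℕ)
    (s : ℂ) : ℂ :=
  (c / (c - 1)) ^ (∑ i, n i) *
    ∑ k ∈ Fintype.piFinset (fun i => Finset.range (n i + 1)),
      (∏ i, ((n i).choose (k i) : ℂ)) *
        ((ascPochhammer ℂ (∑ i, k i)).eval (-s) / c ^ (∑ i, k i)) *
        ∏ m, (ascPochhammer ℂ (n m - k m)).eval
          (s + β m - ((∑ i ∈ Finset.Iic m, k i : ℕ) : ℂ) + (k m : ℂ))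

/-- The raising operator `f ↦ (s + a) f(s) - (s / c) f(s - 1)`. -/
noncomputable def meixnerRaise (c a : ℂ) (f : ℂ → ℂ) (s : ℂ) : ℂ :=
  (s + a) * f s - s / c * f (s - 1)

/-- The operator whose value at the constant function `1` is the unnormalized Meixner polynomial
of degree `n`. -/
noncomputable def meixnerOp (c b : ℂ) (n : ℕ) (f : ℂ → ℂ) (s : ℂ) : ℂ :=
  ∑ k ∈ Finset.range (n + 1), (n.choose k : ℂ) * ((ascPochhammer ℂ k).eval (-s) / c ^ k) *
    (ascPochhammer ℂ (n - k)).eval (s + b) * f (s - k)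

/-- The type II Meixner–Angelesco polynomial without its normalizing factor. -/
noncomputable def meixnerAngelescoSum {r : ℕ} (c : ℂ) (β : Fin r → ℂ) (n : Fin r → ℕ)
    (s : ℂ) : ℂ :=
  ∑ k ∈ Fintype.piFinset (fun i => Finset.range (n i + 1)),
    (∏ i, ((n i).choose (k i) : ℂ)) *
      ((ascPochhammer ℂ (∑ i, k i)).eval (-s) / c ^ (∑ i, k i)) *
      ∏ m, (ascPochhammer ℂ (n m - k m)).eval
        (s + β m - ((∑ i ∈ Finset.Iic m, k i : ℕ) : ℂ) + (k m : ℂ))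

theorem ascPochhammer_succ_eval_left {R : Type*} [CommSemiring R] (n : ℕ) (x : R) :
    (ascPochhammer R (n + 1)).eval x = x * (ascPochhammer R n).eval (x + 1) := by
  simp [ascPochhammer_succ_left]

theorem ascPochhammer_add_eval {R : Type*} [CommSemiring R] (n m : ℕ) (x : R) :
    (ascPochhammer R (n + m)).eval x =
      (ascPochhammer R n).eval x * (ascPochhammer R m).eval (x + n) := by
  simp [← ascPochhammer_mul]

theorem meixnerRaise_comm (c a b : ℂ) (f : ℂ → ℂ) :
    meixnerRaise c a (meixnerRaise c b f) = meixnerRaise c b (meixnerRaise c a f) := by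
  funext s
  simp only [meixnerRaise]
  ring

theorem meixnerOp_zero (c b : ℂ) (f : ℂ → ℂ) : meixnerOp c b 0 f = f := by
  funext s
  simp [meixnerOp]

theorem meixnerOp_succ (c b : ℂ) (n : ℕ) (f : ℂ → ℂ) :
    meixnerOp c b (n + 1) f = meixnerRaise c b (meixnerOp c (b + 1) n f) := by
  funext s
  have hleft : (s + b) * meixnerOp c (b + 1) n f s =
      ∑ k ∈ Finset.range (n + 2), (n.choose k : ℂ) * ((ascPochhammer ℂ k).eval (-s) / c ^ k) *
        (ascPochhammer ℂ (n + 1 - k)).eval (s + b) * f (s - k) := by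
    rw [Finset.sum_range_succ _ (n + 1), Nat.choose_succ_self, meixnerOp, Finset.mul_sum]
    simp only [Nat.cast_zero, zero_mul, add_zero]
    refine Finset.sum_congr rfl fun k hk => ?_
    have hk' : k ≤ n := Nat.lt_succ_iff.mp (Finset.mem_range.mp hk)
    rw [Nat.succ_sub hk', ascPochhammer_succ_eval_left, add_assoc s b 1]
    ring
  have hright : -(s / c) * meixnerOp c (b + 1) n f (s - 1) =
      ∑ k ∈ Finset.range (n + 1), (n.choose k : ℂ) *
        ((ascPochhammer ℂ (k + 1)).eval (-s) / c ^ (k + 1)) *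
        (ascPochhammer ℂ (n + 1 - (k + 1))).eval (s + b) * f (s - (k + 1 : ℕ)) := by
    rw [meixnerOp, Finset.mul_sum]
    refine Finset.sum_congr rfl fun k _ => ?_
    rw [Nat.add_sub_add_right, ascPochhammer_succ_eval_left, pow_succ,
      show s - 1 + (b + 1) = s + b by ring, show -(s - 1) = -s + 1 by ring,
      show s - 1 - (k : ℂ) = s - (k + 1 : ℕ) by push_cast; ring]
    ring
  rw [meixnerRaise, sub_eq_add_neg, ← neg_mul, hleft, hright, meixnerOp,
    Finset.sum_range_succ', Finset.sum_range_succ' _ (n + 1), add_right_comm,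
    ← Finset.sum_add_distrib]
  simp only [Nat.choose_zero_right]
  congr 1
  refine Finset.sum_congr rfl fun k _ => ?_
  rw [Nat.choose_succ_succ']
  push_cast
  ring

theorem meixnerOp_meixnerRaise (c a b : ℂ) (n : ℕ) (f : ℂ → ℂ) :
    meixnerOp c b n (meixnerRaise c a f) = meixnerRaise c a (meixnerOp c b n f) := by
  induction n generalizing b with
  | zero => simp only [meixnerOp_zero]
  | succ n ih => rw [meixnerOp_succ, meixnerOp_succ, ih, meixnerRaise_comm]

theorem meixnerAngelescoSum_succ {r : ℕ} (c : ℂ) (β : Fin (r + 1) → ℂ) (n : Fin (r + 1) → ℕ) :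
    meixnerAngelescoSum c β n =
      meixnerOp c (β 0) (n 0) (meixnerAngelescoSum c (Fin.tail β) (Fin.tail n)) := by
  funext s
  simp only [meixnerOp, meixnerAngelescoSum, Finset.mul_sum]
  rw [← Finset.sum_product']
  refine Finset.sum_nbij' (fun k => (k 0, Fin.tail k)) (fun p => Fin.cons p.1 p.2) ?_ ?_ ?_ ?_ ?_
  · intro k hk
    simp only [Fintype.mem_piFinset, Finset.mem_product] at hk ⊢
    exact ⟨hk 0, fun i => hk i.succ⟩
  · intro p hp
    simp only [Fintype.mem_piFinset, Finset.mem_product] at hp ⊢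
    exact Fin.cases hp.1 hp.2
  · intro k _
    exact Fin.cons_self_tail k
  · intro p _
    simp
  · intro k _
    have hIic : ∑ i ∈ Finset.Iic (0 : Fin (r + 1)), k i = k 0 := by
      rw [show Finset.Iic (0 : Fin (r + 1)) = {0} by ext; simp, Finset.sum_singleton]
    simp only [Fin.prod_univ_succ, Fin.sum_univ_succ, Fin.sum_Iic_succ, hIic, Fin.tail,
      ascPochhammer_add_eval, pow_add, Nat.cast_add]
    rw [sub_add_cancel, show -(s - (k 0 : ℂ)) = -s + k 0 by ring]
    have hprod : ∏ i : Fin r, (ascPochhammer ℂ (n i.succ - k i.succ)).eval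
          (s + β i.succ - ((k 0 : ℂ) + (∑ j ∈ Finset.Iic i, k j.succ : ℕ)) + k i.succ) =
        ∏ i : Fin r, (ascPochhammer ℂ (n i.succ - k i.succ)).eval
          (s - k 0 + β i.succ - (∑ j ∈ Finset.Iic i, k j.succ : ℕ) + k i.succ) :=
      Finset.prod_congr rfl fun i _ => by congr 1; ring
    rw [hprod]
    ring

theorem meixnerAngelescoSum_raising {r : ℕ} (c : ℂ) (β : Fin r → ℂ) (n : Fin r → ℕ)
    (ℓ : Fin r) :
    meixnerAngelescoSum c (Function.update β ℓ (β ℓ - 1)) (Function.update n ℓ (n ℓ + 1)) =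
      meixnerRaise c (β ℓ - 1) (meixnerAngelescoSum c β n) := by
  induction r with
  | zero => exact ℓ.elim0
  | succ r ih =>
    rw [meixnerAngelescoSum_succ, meixnerAngelescoSum_succ c β n]
    cases ℓ using Fin.cases with
    | zero =>
      simp only [Function.update_self, Fin.tail_update_zero, meixnerOp_succ, sub_add_cancel]
    | succ j =>
      rw [Fin.tail_update_succ, Fin.tail_update_succ,
        Function.update_of_ne (Fin.succ_ne_zero j).symm,
        Function.update_of_ne (Fin.succ_ne_zero j).symm, ← meixnerOp_meixnerRaise]
      exact congrArg _ (ih (Fin.tail β) (Fin.tail n) j)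


/-- Raising identity in explicit form:
`M_{n⃗+e_ℓ}^{β⃗−e_ℓ}(s) = (c/(c−1))·((s+β_ℓ−1)·M_{n⃗}^{β⃗}(s) − (s/c)·M_{n⃗}^{β⃗}(s−1))`. -/
theorem meixnerAngelescoII_raising_explicit (r : ℕ) (hr : 1 ≤ r) (β : Fin r → ℂ) (c : ℂ)
    (hc0 : c ≠ 0) (hc1 : c ≠ 1) (n : Fin r → ℕ) (ℓ : Fin r) (s : ℂ) :
    meixnerAngelescoII c (Function.update β ℓ (β ℓ - 1)) (Function.update n ℓ (n ℓ + 1)) s =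
      (c / (c - 1)) * ((s + β ℓ - 1) * meixnerAngelescoII c β n s -
        (s / c) * meixnerAngelescoII c β n (s - 1)) := by
  have hsum : ∑ i, Function.update n ℓ (n ℓ + 1) i = (∑ i, n i) + 1 := by
    rw [Finset.sum_update_of_mem (Finset.mem_univ ℓ),
      ← Finset.add_sum_erase _ n (Finset.mem_univ ℓ), Finset.sdiff_singleton_eq_erase]
    ring
  have h := congrFun (meixnerAngelescoSum_raising c β n ℓ) s
  change _ ^ _ * meixnerAngelescoSum c _ _ s = _ * (_ * (_ * meixnerAngelescoSum c β n s) -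
    _ * (_ * meixnerAngelescoSum c β n (s - 1)))
  rw [h, hsum, pow_succ, meixnerRaise]
  ring
end
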